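/- Let g ≥ 0 and m ≥ 1, put G = g + m, and let τ_0 be a symmetric G×G complex matrix whose upper-left g×g block has negative definite real part. For ε ∈ (0,1) set τ_ε = (1/2)(log ε) · (0_{g×g} ⊕ I_{m×m}) + τ_0 + E_ε, where each E_ε is a symmetric G×G complex matrix and E_ε → 0 as ε → 0⁺. Fix N ∈ {0,1}^G with N_i = 1 for g < i ≤ G, fix M ∈ {0,1}^G, and set S = Π_{i=1}^{G} (2ℤ + N_i) and S_0 = Π_{i=1}^{g} (2ℤ + N_i) × {±1}^m. Assume D_0 := Σ_{s ∈ S_0} exp( Q_{τ_0}(s) + (πi/2)(s·M) ) ≠ 0. Then for all sufficiently small ε > 0 the real part of τ_ε is negative definite and Σ_{s ∈ S} exp( Q_{τ_ε}(s) + (πi/2)(s·M) ) ≠ 0, and for all p, q ∈ {1, …, G}, the ratio ( Σ_{s ∈ S} s_p s_q exp( Q_{τ_ε}(s) + (πi/2) s·M ) ) / ( Σ_{s ∈ S} exp( Q_{τ_ε}(s) + (πi/2) s·M ) ) converges, as ε → 0⁺, to ( Σ_{s ∈ S_0} s_p s_q exp( Q_{τ_0}(s) + (πi/2) s·M ) )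 / D_0. -/

import Mathlib

open scoped BigOperators

attribute [local instance] Classical.propDecidable

/-- `Q_τ(s) = (1/4) Σ_{i,j} τ_{ij} s_i s_j` for an integer vector `s`. -/
noncomputable def Qc {G : ℕ} (τ : Matrix (Fin G) (Fin G) ℂ) (s : Fin G → ℤ) : ℂ :=
  (1/4) * ∑ i, ∑ j, τ i j * (s i : ℂ) * (s j : ℂ)

/-- The real part of `τ` is negative definite. -/
def ReNegDef {G : ℕ} (τ : Matrix (Fin G) (Fin G) ℂ) : Prop :=
  ∀ x : Fin G → ℝ, x ≠ 0 → ∑ i, ∑ j, (τ i j).re * x i * x j < 0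

/-- `s ∈ S`: each coordinate `s i` is congruent to `N i` mod 2. -/
def memS {G : ℕ} (N : Fin G → ℤ) (s : Fin G → ℤ) : Prop :=
  ∀ i, s i % 2 = N i % 2

/-- `s ∈ S₀`: additionally, the coordinates with index `≥ g` lie in `{±1}`. -/
def memS₀ {G : ℕ} (g : ℕ) (N : Fin G → ℤ) (s : Fin G → ℤ) : Prop :=
  memS N s ∧ ∀ i : Fin G, g ≤ (i : ℕ) → s i = 1 ∨ s i = -1


open Filter Topology

/-- Gaussian summability over an integer lattice. -/
lemma summable_gauss_pi (c : ℝ) (hc : 0 < c) (n : ℕ) :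
    Summable (fun s : Fin n → ℤ => Real.exp (-c * ∑ i, (s i : ℝ) ^ 2)) := by
  have h1 : Summable (fun k : ℤ => Real.exp (-c * (k : ℝ) ^ 2)) := by
    have hn : Summable (fun k : ℕ => Real.exp (-c * (k : ℝ) ^ 2)) := by
      refine Summable.of_nonneg_of_le (fun _ => (Real.exp_pos _).le) (fun k => ?_)
        (Real.summable_exp_nat_mul_iff.mpr (neg_lt_zero.mpr hc))
      apply Real.exp_le_exp.mpr
      have : (k : ℝ) ≤ (k : ℝ) ^ 2 := by
        exact_mod_cast Nat.le_self_pow two_ne_zero k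
      nlinarith
    apply Summable.of_nat_of_neg
    · simpa using hn
    · simpa using hn
  induction n with
  | zero => exact Summable.of_finite
  | succ n ih =>
    rw [← (Fin.consEquiv (fun _ : Fin (n + 1) => ℤ)).summable_iff]
    have h2 := Summable.mul_of_nonneg h1 ih (fun _ => (Real.exp_pos _).le)
      (fun _ => (Real.exp_pos _).le)
    refine h2.congr (fun x => ?_)
    simp only [Function.comp, Fin.consEquiv_apply, Fin.sum_univ_succ, Fin.cons_zero, Fin.cons_succ]
    rw [← Real.exp_add]
    congr 1
    ring

lemma summable_gauss_poly (c : ℝ) (hc : 0 < c) (n : ℕ) :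
    Summable (fun s : Fin n → ℤ =>
      (1 + ∑ i, (s i : ℝ) ^ 2) * Real.exp (-c * ∑ i, (s i : ℝ) ^ 2)) := by
  refine Summable.of_nonneg_of_le (fun s => ?_) (fun s => ?_)
    ((summable_gauss_pi (c / 2) (by positivity) n).mul_left (1 + 2 / c))
  · positivity
  · set P := ∑ i, (s i : ℝ) ^ 2 with hP
    have hP0 : 0 ≤ P := Finset.sum_nonneg (fun i _ => sq_nonneg _)
    have h1 : c / 2 * P + 1 ≤ Real.exp (c / 2 * P) := Real.add_one_le_exp _
    have h2 : 1 + P ≤ (1 + 2 / c) * Real.exp (c / 2 * P) := by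
      have h3 : 1 ≤ Real.exp (c / 2 * P) := Real.one_le_exp (by positivity)
      have h4 : P ≤ 2 / c * Real.exp (c / 2 * P) := by
        calc P = 2 / c * (c / 2 * P) := by field_simp
          _ ≤ 2 / c * Real.exp (c / 2 * P) := by gcongr; linarith
      linarith
    calc (1 + P) * Real.exp (-c * P)
        ≤ ((1 + 2 / c) * Real.exp (c / 2 * P)) * Real.exp (-c * P) := by gcongr
      _ = (1 + 2 / c) * Real.exp (-(c / 2) * P) := by
        rw [mul_assoc, ← Real.exp_add]; congr 2; ring

/-- real quadratic form -/
noncomputable def qf {G : ℕ} (τ : Matrix (Fin G) (Fin G) ℂ) (x : Fin G → ℝ) : ℝ :=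
  ∑ i, ∑ j, (τ i j).re * x i * x j

/-- sum of squares of the tail coordinates -/
noncomputable def tl {G : ℕ} (g : ℕ) (x : Fin G → ℝ) : ℝ :=
  ∑ i : Fin G, if g ≤ (i : ℕ) then x i ^ 2 else 0

lemma tl_nonneg {G : ℕ} (g : ℕ) (x : Fin G → ℝ) : 0 ≤ tl g x :=
  Finset.sum_nonneg (fun i _ => by split_ifs <;> positivity)

lemma qf_smul {G : ℕ} (τ : Matrix (Fin G) (Fin G) ℂ) (r : ℝ) (x : Fin G → ℝ) :
    qf τ (r • x) = r ^ 2 * qf τ x := by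
  simp only [qf, Finset.mul_sum, Pi.smul_apply, smul_eq_mul]
  exact Finset.sum_congr rfl fun i _ => Finset.sum_congr rfl fun j _ => by ring

lemma tl_smul {G : ℕ} (g : ℕ) (r : ℝ) (x : Fin G → ℝ) :
    tl g (r • x) = r ^ 2 * tl g x := by
  simp only [tl, Finset.mul_sum, Pi.smul_apply, smul_eq_mul]
  exact Finset.sum_congr rfl fun i _ => by split_ifs <;> ring

lemma qf_cont {G : ℕ} (τ : Matrix (Fin G) (Fin G) ℂ) : Continuous (qf τ) := by
  unfold qf; fun_prop

lemma tl_cont {G : ℕ} (g : ℕ) : Continuous (tl g : (Fin G → ℝ) → ℝ) := by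
  unfold tl
  refine continuous_finsetSum _ fun i _ => ?_
  split_ifs <;> fun_prop

lemma quad_bound (g m : ℕ) (τ₀ : Matrix (Fin (g + m)) (Fin (g + m)) ℂ)
    (hblock : ∀ x : Fin g → ℝ, x ≠ 0 →
      ∑ i, ∑ j, (τ₀ (Fin.castAdd m i) (Fin.castAdd m j)).re * x i * x j < 0) :
    ∃ K δ : ℝ, 0 ≤ K ∧ 0 < δ ∧ ∀ x : Fin (g + m) → ℝ,
      qf τ₀ x - K * tl g x ≤ -δ * ∑ i, x i ^ 2 := by
  set S : Set (Fin (g + m) → ℝ) := {x | ∑ i, x i ^ 2 = 1} with hS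
  have hcomp : IsCompact S := by
    refine Metric.isCompact_of_isClosed_isBounded ?_ ?_
    · exact isClosed_eq (by fun_prop) continuous_const
    · refine (Metric.isBounded_closedBall (x := (0 : Fin (g + m) → ℝ)) (r := 1)).subset ?_
      intro x hx
      rw [mem_closedBall_zero_iff, pi_norm_le_iff_of_nonneg zero_le_one]
      intro i
      rw [Real.norm_eq_abs, ← sq_le_one_iff_abs_le_one]
      calc x i ^ 2 ≤ ∑ i, x i ^ 2 :=
            Finset.single_le_sum (f := fun i => x i ^ 2) (fun i _ => sq_nonneg _) (Finset.mem_univ i)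
        _ = 1 := hx
  have hneg : ∀ x ∈ S, tl g x = 0 → qf τ₀ x < 0 := by
    intro x hx h0
    have hz : ∀ i : Fin m, x (Fin.natAdd g i) = 0 := by
      intro i
      have := (Finset.sum_eq_zero_iff_of_nonneg (fun i _ => by split_ifs <;> positivity)).mp h0
        (Fin.natAdd g i) (Finset.mem_univ _)
      simpa using this
    have hx' : (fun i => x (Fin.castAdd m i)) ≠ 0 := by
      intro h
      have h2 : ∀ i, x (Fin.castAdd m i) = 0 := fun i => congrFun h i
      have : ∑ i, x i ^ 2 = 1 := hx
      rw [Fin.sum_univ_add] at this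
      simp [hz, h2] at this
    have := hblock _ hx'
    simpa [qf, Fin.sum_univ_add, hz] using this
  obtain ⟨n, hn⟩ := hcomp.elim_directed_cover
    (fun n : ℕ => {x | qf τ₀ x - n * tl g x < -(1 / ((n : ℝ) + 1))})
    (fun n => isOpen_lt ((qf_cont τ₀).sub (continuous_const.mul (tl_cont g))) continuous_const)
    (by
      intro x hx
      rw [Set.mem_iUnion]
      have hlim : Tendsto (fun n : ℕ => -(1 / ((n : ℝ) + 1))) atTop (𝓝 0) := by
        simpa using (tendsto_one_div_add_atTop_nhds_zero_nat (𝕜 := ℝ)).neg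
      rcases (tl_nonneg g x).eq_or_lt with h0 | hpos
      · have := hneg x hx h0.symm
        obtain ⟨n, hn⟩ := (hlim.eventually (lt_mem_nhds this)).exists
        exact ⟨n, by simpa [← h0] using hn⟩
      · obtain ⟨n, hn⟩ := exists_nat_gt ((qf τ₀ x + 1) / tl g x)
        refine ⟨n, ?_⟩
        rw [div_lt_iff₀ hpos] at hn
        have : 1 / ((n : ℝ) + 1) ≤ 1 := by
          rw [div_le_one (by positivity)]; linarith [Nat.cast_nonneg (α := ℝ) n]
        simp only [Set.mem_ofPred_eq]
        linarith)
    (by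
      apply Monotone.directed_le
      intro a b hab x hx
      simp only [Set.mem_ofPred_eq] at hx ⊢
      have hab' : (a : ℝ) ≤ b := by exact_mod_cast hab
      have h1 := mul_le_mul_of_nonneg_right hab' (tl_nonneg g x)
      have h2 : 1 / ((b : ℝ) + 1) ≤ 1 / ((a : ℝ) + 1) := by gcongr
      linarith)
  refine ⟨n, 1 / ((n : ℝ) + 1), by positivity, by positivity, fun x => ?_⟩
  set P := ∑ i, x i ^ 2 with hP
  have hP0 : 0 ≤ P := Finset.sum_nonneg (fun i _ => sq_nonneg _)
  rcases hP0.eq_or_lt with h0 | hpos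
  · have hx0 : x = 0 := by
      funext i
      have := (Finset.sum_eq_zero_iff_of_nonneg (fun i _ => sq_nonneg (x i))).mp h0.symm
        i (Finset.mem_univ _)
      simpa using this
    rw [← h0]
    simp [hx0, qf, tl]
  · set r := Real.sqrt P with hr
    have hr0 : 0 < r := Real.sqrt_pos.mpr hpos
    have hr2 : r ^ 2 = P := Real.sq_sqrt hP0
    have hmem : (r⁻¹ • x) ∈ S := by
      simp only [hS, Set.mem_ofPred_eq, Pi.smul_apply, smul_eq_mul, mul_pow, ← Finset.mul_sum]
      rw [← hP, inv_pow, hr2, inv_mul_cancel₀ hpos.ne']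
    have h := hn hmem
    simp only [Set.mem_ofPred_eq, qf_smul, tl_smul, inv_pow, hr2] at h
    have h' := mul_lt_mul_of_pos_left h hpos
    have e : P * (P⁻¹ * qf τ₀ x - n * (P⁻¹ * tl g x)) = qf τ₀ x - n * tl g x := by
      field_simp
    rw [e] at h'
    linarith

lemma qf_small {G : ℕ} (A : Matrix (Fin G) (Fin G) ℂ) (η : ℝ)
    (hA : ∀ i j, ‖A i j‖ ≤ η) (x : Fin G → ℝ) :
    qf A x ≤ η * (G : ℝ) ^ 2 * ∑ i, x i ^ 2 := by
  set P := ∑ i, x i ^ 2 with hP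
  have hle : ∀ i, x i ^ 2 ≤ P := fun i =>
    Finset.single_le_sum (f := fun i => x i ^ 2) (fun i _ => sq_nonneg _) (Finset.mem_univ i)
  have hterm : ∀ i j, (A i j).re * x i * x j ≤ η * P := by
    intro i j
    have h1 : |(A i j).re| ≤ η := (Complex.abs_re_le_norm _).trans (hA i j)
    have h2 : |x i * x j| ≤ P := by
      rw [abs_le]; constructor <;> nlinarith [hle i, hle j, sq_nonneg (x i - x j), sq_nonneg (x i + x j)]
    calc (A i j).re * x i * x j ≤ |(A i j).re * (x i * x j)| := by
          rw [mul_assoc]; exact le_abs_self _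
      _ = |(A i j).re| * |x i * x j| := abs_mul _ _
      _ ≤ η * P := mul_le_mul h1 h2 (abs_nonneg _) ((abs_nonneg _).trans h1)
  calc qf A x ≤ ∑ i : Fin G, ∑ j : Fin G, η * P :=
        Finset.sum_le_sum fun i _ => Finset.sum_le_sum fun j _ => hterm i j
    _ = _ := by simp; ring

lemma Qc_re {G : ℕ} (τ : Matrix (Fin G) (Fin G) ℂ) (s : Fin G → ℤ) :
    (Qc τ s).re = 1 / 4 * qf τ (fun i => (s i : ℝ)) := by
  have h : (1 / 4 : ℂ) = ((1 / 4 : ℝ) : ℂ) := by norm_num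
  rw [Qc, h, Complex.re_ofReal_mul, Complex.re_sum, qf]
  congr 1
  refine Finset.sum_congr rfl fun i _ => ?_
  rw [Complex.re_sum]
  refine Finset.sum_congr rfl fun j _ => ?_
  have : τ i j * (s i : ℂ) * (s j : ℂ) = τ i j * (((s i : ℝ) * (s j : ℝ) : ℝ) : ℂ) := by
    push_cast; ring
  rw [this, Complex.re_mul_ofReal]; ring

lemma phase_re {G : ℕ} (s M : Fin G → ℤ) :
    ((Real.pi * Complex.I / 2) * ∑ i, (s i : ℂ) * (M i : ℂ)).re = 0 := by
  have : (Real.pi * Complex.I / 2) * ∑ i, (s i : ℂ) * (M i : ℂ)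
      = ((Real.pi / 2 * ∑ i, (s i : ℝ) * (M i : ℝ) : ℝ) : ℂ) * Complex.I := by
    push_cast; ring
  rw [this]; simp

/-- decomposition of the quadratic forms -/
lemma Qc_decomp {G : ℕ} (g : ℕ) (T A B : Matrix (Fin G) (Fin G) ℂ) (L : ℝ)
    (h : ∀ i j, T i j = (if i = j ∧ g ≤ (i : ℕ) then (1 / 2 : ℂ) * (L : ℂ) else 0)
        + A i j + B i j) (s : Fin G → ℤ) :
    Qc T s = ((L / 8 * tl g (fun i => (s i : ℝ)) : ℝ) : ℂ) + Qc A s + Qc B s := by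
  have hd : ∑ i : Fin G, ∑ j : Fin G, (if i = j ∧ g ≤ (i : ℕ) then (1 / 2 : ℂ) * (L : ℂ) else 0)
      * (s i : ℂ) * (s j : ℂ) = ((L / 2 * tl g (fun i => (s i : ℝ)) : ℝ) : ℂ) := by
    push_cast [tl, Finset.mul_sum]
    refine Finset.sum_congr rfl fun i _ => ?_
    rw [Finset.sum_eq_single i]
    · by_cases hi : g ≤ (i : ℕ) <;> simp [hi]; ring
    · intro j _ hj; simp [hj.symm]
    · simp
  have : Qc T s = 1 / 4 * (∑ i : Fin G, ∑ j : Fin G, (if i = j ∧ g ≤ (i : ℕ) then (1 / 2 : ℂ) * (L : ℂ) else 0)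
      * (s i : ℂ) * (s j : ℂ)) + Qc A s + Qc B s := by
    simp only [Qc, h, add_mul, Finset.sum_add_distrib]; ring
  rw [this, hd]; push_cast; ring

lemma qf_decomp {G : ℕ} (g : ℕ) (T A B : Matrix (Fin G) (Fin G) ℂ) (L : ℝ)
    (h : ∀ i j, T i j = (if i = j ∧ g ≤ (i : ℕ) then (1 / 2 : ℂ) * (L : ℂ) else 0)
        + A i j + B i j) (x : Fin G → ℝ) :
    qf T x = L / 2 * tl g x + qf A x + qf B x := by
  have hre : ∀ i j, (T i j).re = (if i = j ∧ g ≤ (i : ℕ) then L / 2 else 0)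
        + (A i j).re + (B i j).re := by
    intro i j
    rw [h]
    split_ifs
    · have : (1 / 2 : ℂ) * (L : ℂ) = ((L / 2 : ℝ) : ℂ) := by push_cast; ring
      rw [this]; simp
    · simp
  have hd : ∑ i : Fin G, ∑ j : Fin G, (if i = j ∧ g ≤ (i : ℕ) then L / 2 else 0) * x i * x j
      = L / 2 * tl g x := by
    rw [tl, Finset.mul_sum]
    refine Finset.sum_congr rfl fun i _ => ?_
    rw [Finset.sum_eq_single i]
    · by_cases hi : g ≤ (i : ℕ) <;> simp [hi]; ring
    · intro j _ hj; simp [hj.symm]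
    · simp
  simp only [qf, hre, add_mul, Finset.sum_add_distrib, hd]

lemma card_tl (g m : ℕ) :
    (m : ℝ) = ∑ i : Fin (g + m), if g ≤ (i : ℕ) then (1 : ℝ) else 0 := by
  rw [Fin.sum_univ_add]
  have : ∀ i : Fin g, ¬ g ≤ (i : ℕ) := fun i => not_le.mpr i.2
  simp [this]

lemma tl_sub (g m : ℕ) (s : Fin (g + m) → ℤ) :
    tl g (fun i => (s i : ℝ)) - m
      = ∑ i : Fin (g + m), if g ≤ (i : ℕ) then (s i : ℝ) ^ 2 - 1 else 0 := by
  rw [card_tl g m, tl, ← Finset.sum_sub_distrib]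
  exact Finset.sum_congr rfl fun i _ => by split_ifs <;> simp

lemma odd_sq (N : ℤ) (hN : N = 1) (s : ℤ) (h : s % 2 = N % 2) : (1 : ℝ) ≤ (s : ℝ) ^ 2 := by
  have : s ≠ 0 := by omega
  have : (1 : ℤ) ≤ s ^ 2 := by
    have := pow_pos (abs_pos.mpr this) 2
    rw [sq_abs] at this; omega
  exact_mod_cast this

lemma tl_ge (g m : ℕ) (N s : Fin (g + m) → ℤ)
    (hNtail : ∀ i : Fin (g + m), g ≤ (i : ℕ) → N i = 1) (hs : memS N s) :
    0 ≤ tl g (fun i => (s i : ℝ)) - m := by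
  rw [tl_sub]
  refine Finset.sum_nonneg fun i _ => ?_
  split_ifs with hi
  · linarith [odd_sq (N i) (hNtail i hi) (s i) (hs i)]
  · exact le_rfl

lemma tl_eq_iff (g m : ℕ) (N s : Fin (g + m) → ℤ)
    (hNtail : ∀ i : Fin (g + m), g ≤ (i : ℕ) → N i = 1) (hs : memS N s) :
    tl g (fun i => (s i : ℝ)) - m = 0 ↔ memS₀ g N s := by
  rw [tl_sub, Finset.sum_eq_zero_iff_of_nonneg]
  · constructor
    · intro h
      refine ⟨hs, fun i hi => ?_⟩
      have := h i (Finset.mem_univ _)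
      rw [if_pos hi, sub_eq_zero] at this
      have h2 : s i ^ 2 = 1 := by exact_mod_cast this
      simpa using h2
    · rintro ⟨_, h⟩ i _
      split_ifs with hi
      · rcases h i hi with h | h <;> simp [h]
      · rfl
  · intro i _
    split_ifs with hi
    · linarith [odd_sq (N i) (hNtail i hi) (s i) (hs i)]
    · exact le_rfl

lemma main_tendsto (g m : ℕ)
    (τ₀ : Matrix (Fin (g + m)) (Fin (g + m)) ℂ)
    (E : ℝ → Matrix (Fin (g + m)) (Fin (g + m)) ℂ)
    (hE : ∀ i j, Filter.Tendsto (fun ε => E ε i j)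
      (nhdsWithin 0 (Set.Ioi 0)) (nhds 0))
    (N M : Fin (g + m) → ℤ)
    (hNtail : ∀ i : Fin (g + m), g ≤ (i : ℕ) → N i = 1)
    (τ : ℝ → Matrix (Fin (g + m)) (Fin (g + m)) ℂ)
    (hτ : ∀ ε, ∀ i j, τ ε i j =
      (if i = j ∧ g ≤ (i : ℕ) then (1 / 2 : ℂ) * (Real.log ε : ℂ) else 0)
        + τ₀ i j + E ε i j)
    (K δ : ℝ) (hδ : 0 < δ)
    (hev : ∀ᶠ ε in nhdsWithin 0 (Set.Ioi 0), Real.log ε / 2 ≤ -K ∧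
      ∀ x : Fin (g + m) → ℝ, qf τ₀ x - K * tl g x + qf (E ε) x ≤ -δ * ∑ i, x i ^ 2)
    (w : (Fin (g + m) → ℤ) → ℂ) (hw : ∀ s, ‖w s‖ ≤ 1 + ∑ i, (s i : ℝ) ^ 2) :
    Tendsto (fun ε => ((Real.exp (-(Real.log ε / 8 * m)) : ℝ) : ℂ) *
        ∑' s : Fin (g + m) → ℤ, if memS N s then
          w s * Complex.exp (Qc (τ ε) s
            + (Real.pi * Complex.I / 2) * ∑ i, (s i : ℂ) * (M i : ℂ)) else 0)
      (nhdsWithin 0 (Set.Ioi 0))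
      (nhds (∑' s : Fin (g + m) → ℤ, if memS₀ g N s then
          w s * Complex.exp (Qc τ₀ s
            + (Real.pi * Complex.I / 2) * ∑ i, (s i : ℂ) * (M i : ℂ)) else 0)) := by
  have hkey : ∀ ε s, ((Real.exp (-(Real.log ε / 8 * m)) : ℝ) : ℂ) *
      (w s * Complex.exp (Qc (τ ε) s
            + (Real.pi * Complex.I / 2) * ∑ i, (s i : ℂ) * (M i : ℂ)))
      = ((Real.exp (Real.log ε / 8 * (tl g (fun i => (s i : ℝ)) - m)) : ℝ) : ℂ) *
        (w s * Complex.exp (Qc τ₀ s + Qc (E ε) s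
            + (Real.pi * Complex.I / 2) * ∑ i, (s i : ℂ) * (M i : ℂ))) := by
    intro ε s
    rw [Qc_decomp g (τ ε) τ₀ (E ε) (Real.log ε) (hτ ε) s]
    rw [mul_left_comm, mul_left_comm _ (w s), Complex.ofReal_exp, Complex.ofReal_exp,
      ← Complex.exp_add, ← Complex.exp_add]
    congr 2
    push_cast
    ring
  simp_rw [← tsum_mul_left]
  refine tendsto_tsum_of_dominated_convergence
    (bound := fun s : Fin (g + m) → ℤ => Real.exp (K * m / 4) *
      ((1 + ∑ i, (s i : ℝ) ^ 2) * Real.exp (-(δ / 4) * ∑ i, (s i : ℝ) ^ 2)))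
    ((summable_gauss_poly (δ / 4) (by positivity) _).mul_left _) ?_ ?_
  · intro s
    by_cases hs : memS N s
    swap
    · have : ¬ memS₀ g N s := fun h => hs h.1
      simp [hs, this]
    simp only [if_pos hs, hkey]
    have hEQ : Tendsto (fun ε => Qc (E ε) s) (nhdsWithin 0 (Set.Ioi 0)) (𝓝 0) := by
      have : Tendsto (fun ε => (1/4 : ℂ) * ∑ i, ∑ j, E ε i j * (s i : ℂ) * (s j : ℂ))
          (nhdsWithin 0 (Set.Ioi 0))
          (𝓝 ((1/4 : ℂ) * ∑ i : Fin (g + m), ∑ j : Fin (g + m), 0 * (s i : ℂ) * (s j : ℂ))) :=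
        Tendsto.const_mul _ <| tendsto_finsetSum _ fun i _ => tendsto_finsetSum _ fun j _ =>
          ((hE i j).mul_const _).mul_const _
      simpa [Qc] using this
    have h2 : Tendsto (fun ε => w s * Complex.exp (Qc τ₀ s + Qc (E ε) s
            + (Real.pi * Complex.I / 2) * ∑ i, (s i : ℂ) * (M i : ℂ)))
          (nhdsWithin 0 (Set.Ioi 0)) (𝓝 (w s * Complex.exp (Qc τ₀ s
            + (Real.pi * Complex.I / 2) * ∑ i, (s i : ℂ) * (M i : ℂ)))) := by
      refine Tendsto.const_mul _ ((Complex.continuous_exp.tendsto _).comp ?_)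
      simpa using (hEQ.const_add (Qc τ₀ s)).add_const
        ((Real.pi * Complex.I / 2) * ∑ i, (s i : ℂ) * (M i : ℂ))
    have h1 : Tendsto (fun ε =>
        ((Real.exp (Real.log ε / 8 * (tl g (fun i => (s i : ℝ)) - m)) : ℝ) : ℂ))
        (nhdsWithin 0 (Set.Ioi 0)) (𝓝 (if memS₀ g N s then 1 else 0)) := by
      by_cases h0 : memS₀ g N s
      · rw [(tl_eq_iff g m N s hNtail hs).mpr h0]
        simp [h0]
      · have hne : tl g (fun i => (s i : ℝ)) - m ≠ 0 :=
          fun h => h0 ((tl_eq_iff g m N s hNtail hs).mp h)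
        have hpos := lt_of_le_of_ne (tl_ge g m N s hNtail hs) hne.symm
        rw [if_neg h0, ← Complex.ofReal_zero]
        refine (Complex.continuous_ofReal.tendsto 0).comp (Real.tendsto_exp_atBot.comp ?_)
        exact (Real.tendsto_log_nhdsGT_zero.atBot_div_const (by norm_num)).atBot_mul_const hpos
    have h3 := h1.mul h2
    by_cases h0 : memS₀ g N s
    · simpa [h0] using h3
    · simpa [h0] using h3
  · filter_upwards [hev] with ε hε s
    obtain ⟨hL, hq⟩ := hε
    by_cases hs : memS N s
    swap
    · simp only [if_neg hs, mul_zero, norm_zero]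
      positivity
    simp only [if_pos hs, hkey]
    rw [norm_mul, norm_mul, Complex.norm_exp, Complex.norm_real, Real.norm_eq_abs, Real.abs_exp]
    simp only [Complex.add_re, phase_re, Qc_re]
    have hT := tl_ge g m N s hNtail hs
    have hq' := hq (fun i => (s i : ℝ))
    set T := tl g (fun i => (s i : ℝ))
    set P := ∑ i, (s i : ℝ) ^ 2
    have hexp : Real.log ε / 8 * (T - m) + (1 / 4 * qf τ₀ (fun i => (s i : ℝ))
        + 1 / 4 * qf (E ε) (fun i => (s i : ℝ)) + 0) ≤ K * m / 4 + -(δ / 4) * P := by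
      have := mul_le_mul_of_nonneg_right hL hT
      linarith
    calc _ = ‖w s‖ * Real.exp (Real.log ε / 8 * (T - m) + (1 / 4 * qf τ₀ (fun i => (s i : ℝ))
        + 1 / 4 * qf (E ε) (fun i => (s i : ℝ)) + 0)) := by
          rw [Real.exp_add (Real.log ε / 8 * (T - m))]; ring
      _ ≤ (1 + P) * Real.exp (K * m / 4 + -(δ / 4) * P) := by
        gcongr
        exact hw s
      _ = _ := by rw [Real.exp_add]; ring

theorem stmt10 (g m : ℕ) (hm : 1 ≤ m)
    (τ₀ : Matrix (Fin (g + m)) (Fin (g + m)) ℂ) (hτ₀sym : τ₀.IsSymm)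
    (hblock : ∀ x : Fin g → ℝ, x ≠ 0 →
      ∑ i, ∑ j, (τ₀ (Fin.castAdd m i) (Fin.castAdd m j)).re * x i * x j < 0)
    (E : ℝ → Matrix (Fin (g + m)) (Fin (g + m)) ℂ)
    (hEsym : ∀ ε, (E ε).IsSymm)
    (hE : ∀ i j, Filter.Tendsto (fun ε => E ε i j)
      (nhdsWithin 0 (Set.Ioi 0)) (nhds 0))
    (N M : Fin (g + m) → ℤ)
    (hN01 : ∀ i, N i = 0 ∨ N i = 1) (hM01 : ∀ i, M i = 0 ∨ M i = 1)
    (hNtail : ∀ i : Fin (g + m), g ≤ (i : ℕ) → N i = 1)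
    (τ : ℝ → Matrix (Fin (g + m)) (Fin (g + m)) ℂ)
    (hτ : ∀ ε, ∀ i j, τ ε i j =
      (if i = j ∧ g ≤ (i : ℕ) then (1 / 2 : ℂ) * (Real.log ε : ℂ) else 0)
        + τ₀ i j + E ε i j)
    (hD₀ : (∑' s : Fin (g + m) → ℤ, if memS₀ g N s then
        Complex.exp (Qc τ₀ s
          + (Real.pi * Complex.I / 2) * ∑ i, (s i : ℂ) * (M i : ℂ)) else 0) ≠ 0) :
    (∀ᶠ ε in nhdsWithin 0 (Set.Ioi 0),
      ReNegDef (τ ε) ∧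
      (∑' s : Fin (g + m) → ℤ, if memS N s then
          Complex.exp (Qc (τ ε) s
            + (Real.pi * Complex.I / 2) * ∑ i, (s i : ℂ) * (M i : ℂ)) else 0) ≠ 0) ∧
    ∀ p q : Fin (g + m),
      Filter.Tendsto (fun ε =>
          (∑' s : Fin (g + m) → ℤ, if memS N s then
              (s p : ℂ) * (s q : ℂ) * Complex.exp (Qc (τ ε) s
                + (Real.pi * Complex.I / 2) * ∑ i, (s i : ℂ) * (M i : ℂ)) else 0)
          / (∑' s : Fin (g + m) → ℤ, if memS N s then
              Complex.exp (Qc (τ ε) s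
                + (Real.pi * Complex.I / 2) * ∑ i, (s i : ℂ) * (M i : ℂ)) else 0))
        (nhdsWithin 0 (Set.Ioi 0))
        (nhds ((∑' s : Fin (g + m) → ℤ, if memS₀ g N s then
              (s p : ℂ) * (s q : ℂ) * Complex.exp (Qc τ₀ s
                + (Real.pi * Complex.I / 2) * ∑ i, (s i : ℂ) * (M i : ℂ)) else 0)
          / (∑' s : Fin (g + m) → ℤ, if memS₀ g N s then
              Complex.exp (Qc τ₀ s
                + (Real.pi * Complex.I / 2) * ∑ i, (s i : ℂ) * (M i : ℂ)) else 0))) := by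
  obtain ⟨K, δ, hK, hδ, hquad⟩ := quad_bound g m τ₀ hblock
  have hev : ∀ᶠ ε in nhdsWithin 0 (Set.Ioi 0), Real.log ε / 2 ≤ -K ∧
      ∀ x : Fin (g + m) → ℝ, qf τ₀ x - K * tl g x + qf (E ε) x ≤ -(δ / 2) * ∑ i, x i ^ 2 := by
    set η : ℝ := δ / 2 / ((g + m : ℕ) : ℝ) ^ 2 with hη
    have hG : (0 : ℝ) < ((g + m : ℕ) : ℝ) := by
      have : 0 < g + m := by omega
      exact_mod_cast this
    have hη0 : 0 < η := by positivity
    have hsmall : ∀ᶠ ε in nhdsWithin 0 (Set.Ioi 0), ∀ i j, ‖E ε i j‖ ≤ η := by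
      rw [Filter.eventually_all]; intro i
      rw [Filter.eventually_all]; intro j
      have h := (hE i j).norm
      rw [norm_zero] at h
      exact (h.eventually (gt_mem_nhds hη0)).mono fun _ h => h.le
    filter_upwards [hsmall,
      (Real.tendsto_log_nhdsGT_zero.atBot_div_const (by norm_num : (0 : ℝ) < 2)).eventually
        (Filter.eventually_le_atBot (-K))] with ε h1 h2
    refine ⟨h2, fun x => ?_⟩
    have h3 := qf_small (E ε) η h1 x
    have h4 : η * ((g + m : ℕ) : ℝ) ^ 2 = δ / 2 := by rw [hη]; field_simp
    rw [h4] at h3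
    linarith [hquad x]
  have hsq : ∀ (s : Fin (g + m) → ℤ) i, (s i : ℝ) ^ 2 ≤ ∑ i, (s i : ℝ) ^ 2 := fun s i =>
    Finset.single_le_sum (f := fun i => (s i : ℝ) ^ 2) (fun i _ => sq_nonneg _) (Finset.mem_univ i)
  have hden := main_tendsto g m τ₀ E hE N M hNtail τ hτ K (δ / 2) (by positivity) hev
    (fun _ => 1) (fun s => by
      have : 0 ≤ ∑ i, (s i : ℝ) ^ 2 := Finset.sum_nonneg (fun i _ => sq_nonneg _)
      simpa using this)
  simp only [one_mul] at hden
  refine ⟨?_, fun p q => ?_⟩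
  · filter_upwards [hev, hden.eventually_ne hD₀] with ε h1 h2
    refine ⟨fun x hx => ?_, right_ne_zero_of_mul h2⟩
    have hP : 0 < ∑ i, x i ^ 2 := by
      obtain ⟨i, hi⟩ := Function.ne_iff.mp hx
      exact Finset.sum_pos' (fun i _ => sq_nonneg _) ⟨i, Finset.mem_univ _, (sq_pos_iff.mpr hi)⟩
    change qf (τ ε) x < 0
    rw [qf_decomp g (τ ε) τ₀ (E ε) (Real.log ε) (hτ ε) x]
    have h3 := mul_le_mul_of_nonneg_right h1.1 (tl_nonneg g x)
    have h4 := h1.2 x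
    have h5 : 0 < δ / 2 * ∑ i, x i ^ 2 := by positivity
    linarith
  · have hnum := main_tendsto g m τ₀ E hE N M hNtail τ hτ K (δ / 2) (by positivity) hev
      (fun s => (s p : ℂ) * (s q : ℂ)) (fun s => by
        have h1 : ‖(s p : ℂ) * (s q : ℂ)‖ = |(s p : ℝ) * (s q : ℝ)| := by
          rw [← Real.norm_eq_abs, ← Complex.norm_real]; push_cast; rfl
        rw [h1, abs_le]
        constructor <;> nlinarith [hsq s p, hsq s q, sq_nonneg ((s p : ℝ) - s q),
          sq_nonneg ((s p : ℝ) + s q)])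
    refine (hnum.div hden hD₀).congr fun ε => ?_
    exact mul_div_mul_left _ _ (by simpa using (Complex.exp_ne_zero _))
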